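/- arXiv:1709.04044 — 2 statements merged into one kernel-verified Lean document; each statement's English description precedes it below -/
import Mathlib

section
/- Let E be a finite-dimensional real inner product space whose inner product s(·,·) decomposes as s = Σ_{k=1}^N s_k, where each s_k is a symmetric positive semidefinite bilinear form on E. Let K̃ ⊆ E be a subspace. For each k and each ν ∈ E there is a unique element P_k ν ∈ K̃ satisfying s(P_k ν, μ̃) = s_k(ν, μ̃) for all μ̃ ∈ K̃, and it satisfies s(P_k ν, P_k ν) ≤ s_k(ν, ν). Consequently Σ_{k=1}^N s(P_k ν, P_k ν) ≤ s(ν, ν) for every ν ∈ E. -/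
open RealInnerProductSpace

/-- A linear functional on a finite-dimensional inner product space is represented, on a
subspace `K`, by a unique element of `K`. -/
theorem existsUnique_mem_forall_inner_eq {E : Type*} [NormedAddCommGroup E]
    [InnerProductSpace ℝ E] [FiniteDimensional ℝ E] (K : Submodule ℝ E) (f : E →ₗ[ℝ] ℝ) :
    ∃! p : E, p ∈ K ∧ ∀ μ ∈ K, ⟪p, μ⟫ = f μ := by
  let q : K := (InnerProductSpace.toDual ℝ K).symm
    (LinearMap.toContinuousLinearMap (f ∘ₗ K.subtype))
  have hq : ∀ μ ∈ K, ⟪(q : E), μ⟫ = f μ := fun μ hμ =>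
    InnerProductSpace.toDual_symm_apply (x := (⟨μ, hμ⟩ : K))
      (y := LinearMap.toContinuousLinearMap (f ∘ₗ K.subtype))
  refine ⟨q, ⟨q.2, hq⟩, ?_⟩
  rintro p ⟨hp, hpf⟩
  have hmem : p - q ∈ K := K.sub_mem hp q.2
  rw [← sub_eq_zero, ← inner_self_eq_zero (𝕜 := ℝ), inner_sub_left, hpf _ hmem, hq _ hmem,
    sub_self]

/-- If a symmetric positive semidefinite form `b` is dominated by the inner product at `p` and
`⟪p, p⟫ = b ν p`, then `⟪p, p⟫ ≤ b ν ν`. -/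
theorem inner_self_le_of_inner_self_eq {E : Type*} [NormedAddCommGroup E]
    [InnerProductSpace ℝ E] (b : E →ₗ[ℝ] E →ₗ[ℝ] ℝ) (hsymm : ∀ u v, b u v = b v u)
    (hpsd : ∀ v, 0 ≤ b v v) {ν p : E} (hle : b p p ≤ ⟪p, p⟫) (hp : ⟪p, p⟫ = b ν p) :
    ⟪p, p⟫ ≤ b ν ν := by
  have h := hpsd (ν - p)
  simp only [map_sub, LinearMap.sub_apply] at h
  linarith [hsymm ν p]

/-- Existence, uniqueness and stability of the elementwise correction operators:
each corrector `P_k ν` exists, is unique, satisfies `s(P_k ν, P_k ν) ≤ s_k(ν,ν)`,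
and the correctors are collectively stable: `Σ_k s(P_k ν, P_k ν) ≤ s(ν,ν)`. -/
theorem corrector_stability {E : Type*} [NormedAddCommGroup E]
    [InnerProductSpace ℝ E] [FiniteDimensional ℝ E]
    (N : ℕ) (s : Fin N → E →ₗ[ℝ] E →ₗ[ℝ] ℝ)
    (hsymm : ∀ (k : Fin N) (u v : E), s k u v = s k v u)
    (hpsd : ∀ (k : Fin N) (v : E), 0 ≤ s k v v)
    (hsum : ∀ u v : E, ⟪u, v⟫ = ∑ k, s k u v)
    (K : Submodule ℝ E) :
    (∀ (k : Fin N) (ν : E), ∃! p : E, p ∈ K ∧ ∀ μ ∈ K, ⟪p, μ⟫ = s k ν μ) ∧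
    (∀ (k : Fin N) (ν p : E), p ∈ K → (∀ μ ∈ K, ⟪p, μ⟫ = s k ν μ) →
        ⟪p, p⟫ ≤ s k ν ν) ∧
    (∀ (ν : E) (P : Fin N → E),
        (∀ k, P k ∈ K ∧ ∀ μ ∈ K, ⟪P k, μ⟫ = s k ν μ) →
        ∑ k, ⟪P k, P k⟫ ≤ ⟪ν, ν⟫) := by
  have hle (k : Fin N) (v : E) : s k v v ≤ ⟪v, v⟫ := by
    rw [hsum]
    exact Finset.single_le_sum (f := fun j => s j v v) (fun j _ => hpsd j v) (Finset.mem_univ k)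
  have hstab (k : Fin N) (ν p : E) (hp : p ∈ K) (h : ∀ μ ∈ K, ⟪p, μ⟫ = s k ν μ) :
      ⟪p, p⟫ ≤ s k ν ν :=
    inner_self_le_of_inner_self_eq (s k) (hsymm k) (hpsd k) (hle k p) (h p hp)
  refine ⟨fun k ν => existsUnique_mem_forall_inner_eq K (s k ν), hstab, fun ν P hP => ?_⟩
  rw [hsum ν ν]
  exact Finset.sum_le_sum fun k _ => hstab k ν (P k) (hP k).1 (hP k).2
end

section
/- Let V be a finite-dimensional real vector space equipped with two inner products a(·,·) and m(·,·). Let ψ₁, …, ψ_n be a basis of V and 0 < λ₁ ≤ λ₂ ≤ … ≤ λ_n be reals such that a(v, ψ_i) = λ_i m(v, ψ_i) for all v ∈ V and all i, and such that m(ψ_i, ψ_j) = δ_{ij}. Given ℋ > 0, set V^ms := span{ψ_i : λ_i < ℋ⁻²}. Let g ∈ V, let u ∈ V satisfy a(u, v) = m(g, v) for all v ∈ V, and let u^ms ∈ V^ms satisfy a(u^ms, v) = m(g, v) for all v ∈ V^ms. Then a(u − u^ms, u − u^ms) ≤ ℋ² · m(g, g). -/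
/-- Expansion of a vector in a spanning family that is orthonormal for a bilinear form. -/
theorem eq_sum_smul_of_orthonormal_of_span_eq_top {V ι : Type*} [AddCommGroup V] [Module ℝ V]
    [Fintype ι] [DecidableEq ι] (m : V →ₗ[ℝ] V →ₗ[ℝ] ℝ) (ψ : ι → V)
    (hspan : Submodule.span ℝ (Set.range ψ) = ⊤)
    (horth : ∀ i j, m (ψ i) (ψ j) = if i = j then 1 else 0) (v : V) :
    v = ∑ i, m v (ψ i) • ψ i := by
  have hv : v ∈ Submodule.span ℝ (Set.range ψ) := hspan ▸ Submodule.mem_top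
  obtain ⟨c, rfl⟩ := (Submodule.mem_span_range_iff_exists_fun ℝ).1 hv
  simp [map_sum, horth]

/-- A vector spanned by the members of an orthonormal family indexed by `s` is orthogonal to
the members indexed outside `s`. -/
theorem apply_eq_zero_of_mem_span_image_of_orthonormal {V ι : Type*} [AddCommGroup V]
    [Module ℝ V] [DecidableEq ι] (m : V →ₗ[ℝ] V →ₗ[ℝ] ℝ) (ψ : ι → V)
    (horth : ∀ i j, m (ψ i) (ψ j) = if i = j then 1 else 0) {s : Set ι} {v : V}
    (hv : v ∈ Submodule.span ℝ (ψ '' s)) {j : ι} (hj : j ∉ s) : m v (ψ j) = 0 := by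
  have hle : Submodule.span ℝ (ψ '' s) ≤ LinearMap.ker (m.flip (ψ j)) := by
    rw [Submodule.span_le]
    rintro _ ⟨i, hi, rfl⟩
    have hij : i ≠ j := fun h => hj (h ▸ hi)
    simp [horth, hij]
  simpa using hle hv

/-- Abstract elementwise spectral multiscale estimate (Section 5):
the Galerkin error in the span of the eigenfunctions with `λ_i < ℋ⁻²`
satisfies `a(u - u^ms, u - u^ms) ≤ ℋ² m(g, g)`. -/
theorem elementwise_spectral_estimate {V : Type*} [AddCommGroup V] [Module ℝ V]
    [FiniteDimensional ℝ V]
    (n : ℕ) (a m : V →ₗ[ℝ] V →ₗ[ℝ] ℝ)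
    (hasymm : ∀ u v : V, a u v = a v u) (hmsymm : ∀ u v : V, m u v = m v u)
    (hapos : ∀ v : V, v ≠ 0 → 0 < a v v) (hmpos : ∀ v : V, v ≠ 0 → 0 < m v v)
    (ψ : Fin n → V) (lam : Fin n → ℝ)
    (hindep : LinearIndependent ℝ ψ) (hspan : Submodule.span ℝ (Set.range ψ) = ⊤)
    (hlampos : ∀ i, 0 < lam i) (hlammono : Monotone lam)
    (heig : ∀ (v : V) (i : Fin n), a v (ψ i) = lam i * m v (ψ i))
    (horth : ∀ i j, m (ψ i) (ψ j) = if i = j then 1 else 0)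
    (H : ℝ) (hH : 0 < H)
    (g u ums : V)
    (hu : ∀ v : V, a u v = m g v)
    (hums : ums ∈ Submodule.span ℝ (ψ '' {i | lam i < (H ^ 2)⁻¹}))
    (hums' : ∀ v ∈ Submodule.span ℝ (ψ '' {i | lam i < (H ^ 2)⁻¹}), a ums v = m g v) :
    a (u - ums) (u - ums) ≤ H ^ 2 * m g g := by
  have expand := eq_sum_smul_of_orthonormal_of_span_eq_top m ψ hspan horth
  have parseval (b : V →ₗ[ℝ] V →ₗ[ℝ] ℝ) (v : V) :
      b v v = ∑ i, m v (ψ i) * b v (ψ i) := by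
    have h := congrArg (b v) (expand v)
    simpa only [map_sum, map_smul, smul_eq_mul] using h
  rw [parseval a, parseval m, Finset.mul_sum]
  refine Finset.sum_le_sum fun i _ => ?_
  by_cases hi : lam i < (H ^ 2)⁻¹
  · have hres : a (u - ums) (ψ i) = 0 := by
      rw [map_sub, LinearMap.sub_apply, hu,
        hums' _ (Submodule.subset_span (Set.mem_image_of_mem ψ hi)), sub_self]
    rw [hres, mul_zero]
    exact mul_nonneg (sq_nonneg H) (mul_self_nonneg _)
  · have hzero : m ums (ψ i) = 0 :=
      apply_eq_zero_of_mem_span_image_of_orthonormal m ψ horth hums hi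
    have hcoef : m (u - ums) (ψ i) = m u (ψ i) := by simp [hzero]
    have hone : 1 ≤ H ^ 2 * lam i := by
      rw [not_lt] at hi
      exact (inv_le_iff_one_le_mul₀' (by positivity)).1 hi
    have hg : m g (ψ i) = lam i * m u (ψ i) := by rw [← hu, heig]
    rw [heig, hcoef, hg]
    calc m u (ψ i) * (lam i * m u (ψ i)) = 1 * (lam i * m u (ψ i) ^ 2) := by ring
      _ ≤ H ^ 2 * lam i * (lam i * m u (ψ i) ^ 2) :=
        mul_le_mul_of_nonneg_right hone (mul_nonneg (hlampos i).le (sq_nonneg _))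
      _ = H ^ 2 * (lam i * m u (ψ i) * (lam i * m u (ψ i))) := by ring
end
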